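/- Let k be a field of characteristic p > 0, let α be a natural number, set q = p^α, and write V_s for the k[x]-module k[x]/(x−1)^s (with V_0 = 0). For every integer r with (p−1)q < r ≤ pq there is an isomorphism of k[x]-modules (V_{q+1} ⊗ V_r) ⊕ V_{(2p−1)q−r} ≅ (V_{q−1} ⊗ V_r) ⊕ V_{r−q} ⊕ V_{pq} ⊕ V_{pq}. -/

import Mathlib

set_option maxHeartbeats 1000000

open Polynomial TensorProduct

/-- The `k`-linear operator on the `k[x]`-module `k[x]/(h)` given by the action of `x`,
i.e. multiplication by `x`. -/
noncomputable def mulXop (k : Type*) [Field k] (h : k[X]) :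
    (k[X] ⧸ Ideal.span {h}) →ₗ[k] (k[X] ⧸ Ideal.span {h}) :=
  LinearMap.mulLeft k (Ideal.Quotient.mk (Ideal.span {h}) X)

/-- Two `k[x]`-modules, presented as vector spaces equipped with the `k`-linear operator
by which `x` acts, are isomorphic iff there is a `k`-linear equivalence intertwining the
two operators. -/
def OpIso {k V W : Type*} [Field k] [AddCommGroup V] [Module k V]
    [AddCommGroup W] [Module k W] (f : V →ₗ[k] V) (g : W →ₗ[k] W) : Prop :=
  ∃ e : V ≃ₗ[k] W, ∀ v, e (f v) = g (e v)

/-- The direct sum of a family of operators, as an operator on the direct sum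
(product) of the underlying spaces. -/
def piOp {k : Type*} [Field k] {ι : Type*} {V : ι → Type*} [∀ i, AddCommGroup (V i)]
    [∀ i, Module k (V i)] (f : ∀ i, V i →ₗ[k] V i) : (∀ i, V i) →ₗ[k] (∀ i, V i) :=
  LinearMap.pi fun i => (f i).comp (LinearMap.proj i)

section aux

theorem OpIso.symm' {k V W : Type*} [Field k] [AddCommGroup V] [Module k V]
    [AddCommGroup W] [Module k W] {f : V →ₗ[k] V} {g : W →ₗ[k] W} (h : OpIso f g) :
    OpIso g f := by
  obtain ⟨e, he⟩ := h
  refine ⟨e.symm, fun v => ?_⟩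
  rw [LinearEquiv.symm_apply_eq, he, LinearEquiv.apply_symm_apply]

theorem OpIso.trans' {k V W U : Type*} [Field k] [AddCommGroup V] [Module k V]
    [AddCommGroup W] [Module k W] [AddCommGroup U] [Module k U]
    {f : V →ₗ[k] V} {g : W →ₗ[k] W} {h : U →ₗ[k] U} (h1 : OpIso f g) (h2 : OpIso g h) :
    OpIso f h := by
  obtain ⟨e, he⟩ := h1
  obtain ⟨e', he'⟩ := h2
  exact ⟨e.trans e', fun v => by simp [he, he']⟩

/-- The operator `f` has Jordan type `S` (unipotent). -/
def HasType {k V : Type*} [Field k] [AddCommGroup V] [Module k V] (f : V →ₗ[k] V)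
    (S : Multiset ℕ) : Prop :=
  ∃ (ι : Type) (_ : Fintype ι) (c : ι → ℕ), (Finset.univ : Finset ι).val.map c = S ∧
    OpIso f (piOp fun i => mulXop k ((X - 1) ^ c i))

theorem exists_equiv_of_map {ι κ : Type} [Fintype ι] [Fintype κ] (c : ι → ℕ) (d : κ → ℕ)
    (h : (Finset.univ : Finset ι).val.map c = (Finset.univ : Finset κ).val.map d) :
    ∃ σ : ι ≃ κ, ∀ i, d (σ i) = c i := by
  classical
  have h1 : ∀ v, Nonempty ({i // c i = v} ≃ {j // d j = v}) := by
    intro v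
    rw [← Fintype.card_eq]
    have := congrArg (Multiset.count v) h
    rw [Multiset.count_map, Multiset.count_map] at this
    rw [Fintype.card_subtype, Fintype.card_subtype]
    simp only [eq_comm (a := v)] at this
    exact this
  have e := fun v => (h1 v).some
  refine ⟨(Equiv.sigmaFiberEquiv c).symm.trans
    ((Equiv.sigmaCongrRight e).trans (Equiv.sigmaFiberEquiv d)), fun i => ?_⟩
  simp only [Equiv.trans_apply]
  exact (e (c i) ⟨i, rfl⟩).2

theorem HasType.opIso {k V W : Type*} [Field k] [AddCommGroup V] [Module k V]
    [AddCommGroup W] [Module k W] {f : V →ₗ[k] V} {g : W →ₗ[k] W} {S : Multiset ℕ}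
    (hf : HasType f S) (hg : HasType g S) : OpIso f g := by
  obtain ⟨ι, _, c, hc, h1⟩ := hf
  obtain ⟨κ, _, d, hd, h2⟩ := hg
  refine h1.trans' (OpIso.trans' ?_ h2.symm')
  obtain ⟨σ, hσ⟩ := exists_equiv_of_map c d (hc.trans hd.symm)
  obtain rfl : (fun i => d (σ i)) = c := funext hσ
  refine OpIso.symm' ⟨(LinearEquiv.piCongrLeft k
    (fun j => k[X] ⧸ Ideal.span {((X : k[X]) - 1) ^ d j}) σ).symm, ?_⟩
  intro v
  rfl

theorem HasType.cons {k V : Type*} [Field k] [AddCommGroup V] [Module k V]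
    {f : V →ₗ[k] V} {S : Multiset ℕ}
    (hf : HasType f S) (a : ℕ) : HasType (f.prodMap (mulXop k ((X - 1) ^ a))) (a ::ₘ S) := by
  obtain ⟨ι, _, c, hc, e, he⟩ := hf
  refine ⟨Option ι, inferInstance, fun o => o.elim a c, ?_, ?_⟩
  · rw [← hc]
    have : (Finset.univ : Finset (Option ι)).val = none ::ₘ (Finset.univ : Finset ι).val.map some :=
      rfl
    rw [this, Multiset.map_cons, Multiset.map_map]
    rfl
  · refine ⟨LinearEquiv.ofBijective
      { toFun := fun v => fun o => match o with
          | none => v.2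
          | some i => e v.1 i
        map_add' := ?_, map_smul' := ?_ } ⟨?_, ?_⟩, ?_⟩
    · intro v w; funext o
      cases o with
      | none => rfl
      | some i => exact congrFun (map_add e v.1 w.1) i
    · intro v w; funext o
      cases o with
      | none => rfl
      | some i => exact congrFun (map_smul e v w.1) i
    · intro v w h
      have h0 := congrFun h none
      have h1 : e v.1 = e w.1 := funext fun i => congrFun h (some i)
      exact Prod.ext (e.injective h1) h0
    · intro v
      refine ⟨(e.symm fun i => v (some i), v none), ?_⟩
      funext o
      cases o with
      | none => rfl
      | some i => exact congrFun (e.apply_symm_apply fun i => v (some i)) i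
    · intro v
      funext o
      cases o with
      | none => rfl
      | some i => exact congrFun (he v.1) i

instance finite_quot (k : Type*) [Field k] (a : ℕ) :
    Module.Finite k (k[X] ⧸ Ideal.span {((X : k[X]) - 1) ^ a}) := by
  have : ((X : k[X]) - 1) ^ a = (X - C 1) ^ a := by simp
  rw [this]
  exact ((monic_X_sub_C (1 : k)).pow a).finite_quotient

theorem finrank_quot (k : Type*) [Field k] (a : ℕ) :
    Module.finrank k (k[X] ⧸ Ideal.span {((X : k[X]) - 1) ^ a}) = a := by
  have : ((X : k[X]) - 1) ^ a = (X - C 1) ^ a := by simp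
  rw [this, finrank_quotient_span_eq_natDegree' ((monic_X_sub_C (1 : k)).pow a), natDegree_pow,
    natDegree_X_sub_C, mul_one]

/-- Generators-and-dimension criterion. -/
theorem hasType_of_gens {k R : Type*} [Field k] [CommRing R] [Algebra k R] [Module.Finite k R]
    (z : R) {n : ℕ} (e : Fin n → R) (c : Fin n → ℕ)
    (h0 : ∀ i, (z - 1) ^ c i * e i = 0)
    (hspan : ∀ N : Submodule k R, (∀ v ∈ N, z * v ∈ N) → (∀ i, e i ∈ N) → N = ⊤)
    (hdim : ∑ i, c i = Module.finrank k R) :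
    OpIso (LinearMap.mulLeft k z) (piOp fun i => mulXop k ((X - 1) ^ c i)) := by
  apply OpIso.symm'
  let φ : ∀ i, (k[X] ⧸ Ideal.span {((X : k[X]) - 1) ^ c i}) →ₗ[k] R := fun i =>
    Submodule.liftQ ((Ideal.span {((X : k[X]) - 1) ^ c i}).restrictScalars k)
      ((LinearMap.mulRight k (e i)).comp (aeval z).toLinearMap) (by
        intro g hg
        have hg : g ∈ Ideal.span {((X : k[X]) - 1) ^ c i} := hg
        rw [Ideal.mem_span_singleton] at hg
        obtain ⟨g', rfl⟩ := hg
        rw [LinearMap.mem_ker]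
        simp only [LinearMap.comp_apply, AlgHom.toLinearMap_apply, LinearMap.mulRight_apply,
          map_mul, map_pow, map_sub, aeval_X, map_one]
        rw [mul_right_comm, h0, zero_mul])
  have hφ : ∀ i g, φ i (Ideal.Quotient.mk _ g) = aeval z g * e i := fun i g => rfl
  have hφX : ∀ i v, φ i (mulXop k ((X - 1) ^ c i) v) = z * φ i v := by
    intro i v
    obtain ⟨g, rfl⟩ := Ideal.Quotient.mk_surjective v
    have : mulXop k ((X - 1) ^ c i) (Ideal.Quotient.mk _ g) = Ideal.Quotient.mk _ (X * g) := by
      simp [mulXop]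
    rw [this, hφ, hφ, map_mul, aeval_X, mul_assoc]
  let Φ := LinearMap.lsum k (fun i => k[X] ⧸ Ideal.span {((X : k[X]) - 1) ^ c i}) k φ
  have hΦ : ∀ v, Φ v = ∑ i, φ i (v i) := fun v => by simp [Φ]
  have hΦX : ∀ v, Φ (piOp (fun i => mulXop k ((X - 1) ^ c i)) v) = z * Φ v := by
    intro v
    rw [hΦ, hΦ, Finset.mul_sum]
    exact Finset.sum_congr rfl fun i _ => hφX i (v i)
  have hsurj : Function.Surjective Φ := by
    rw [← LinearMap.range_eq_top]
    apply hspan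
    · rintro _ ⟨v, rfl⟩
      exact ⟨_, hΦX v⟩
    · intro i
      classical
      refine ⟨Pi.single i (Ideal.Quotient.mk _ 1), ?_⟩
      rw [hΦ, Finset.sum_eq_single i]
      · rw [Pi.single_eq_same, hφ]; simp
      · intro j _ hj
        rw [Pi.single_eq_of_ne hj, map_zero]
      · simp
  have hd : Module.finrank k (∀ i, k[X] ⧸ Ideal.span {((X : k[X]) - 1) ^ c i})
      = Module.finrank k R := by
    rw [Module.finrank_pi_fintype, ← hdim]
    exact Finset.sum_congr rfl fun i _ => finrank_quot k _
  have hinj : Function.Injective Φ :=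
    (LinearMap.injective_iff_surjective_of_finrank_eq_finrank hd).2 hsurj
  exact ⟨LinearEquiv.ofBijective Φ ⟨hinj, hsurj⟩, hΦX⟩

/-- Spanning criterion: unitriangular generators. -/
theorem span_of_tri {k R : Type*} [Field k] [CommRing R] [Algebra k R]
    (z t : R) (m : ℕ) (hm : (z - 1 - t) ^ m = 0)
    (hadj : Algebra.adjoin k {z - 1, t} = ⊤) (e : ℕ → R)
    (N : Submodule k R) (hN : ∀ v ∈ N, z * v ∈ N) (he : ∀ i < m, e i ∈ N)
    (htri : ∀ i < m, (∀ a, ∀ j < i, (z - 1) ^ a * t ^ j ∈ N) → e i - t ^ i ∈ N) :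
    N = ⊤ := by
  have hw : ∀ a, ∀ v ∈ N, (z - 1) ^ a * v ∈ N := by
    intro a
    induction a with
    | zero => intro v hv; simpa using hv
    | succ a ih =>
      intro v hv
      have := ih _ (N.sub_mem (hN v hv) hv)
      convert this using 1
      ring
  have ht : ∀ i, t ^ i ∈ N := by
    intro i
    induction i using Nat.strong_induction_on with
    | _ i ih =>
      rcases lt_or_ge i m with hi | hi
      · have h1 := htri i hi fun a j hj => hw a _ (ih j hj)
        have := N.sub_mem (he i hi) h1
        simpa using this
      · have h2 : (t + -(z - 1)) ^ m = 0 := by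
          have : t + -(z - 1) = -(z - 1 - t) := by ring
          rw [this, neg_pow, hm, mul_zero]
        rw [add_pow, Finset.sum_range_succ] at h2
        have h3 : t ^ i = -∑ j ∈ Finset.range m,
            t ^ (i - m) * (t ^ j * (-(z - 1)) ^ (m - j) * (m.choose j : R)) := by
          rw [← Finset.mul_sum, eq_neg_of_add_eq_zero_left h2]
          simp [← pow_add, Nat.sub_add_cancel hi]
        rw [h3]
        refine N.neg_mem (N.sum_mem fun j hj => ?_)
        have hj := Finset.mem_range.1 hj
        have h4 := N.smul_mem ((-1 : k) ^ (m - j) * (m.choose j : k))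
          (hw (m - j) _ (ih (j + (i - m)) (by omega)))
        convert h4 using 1
        rw [Algebra.smul_def]
        simp only [map_mul, map_pow, map_neg, map_one, map_natCast]
        rw [neg_pow (z - 1)]
        ring
  have h5 : Subalgebra.toSubmodule (Algebra.adjoin k {z - 1, t}) ≤ N := by
    rw [Algebra.adjoin_eq_span, Submodule.span_le]
    intro v hv
    obtain ⟨a, b, rfl⟩ := (Submonoid.mem_closure_pair _ _ _).1 hv
    exact hw a _ (ht b)
  rw [hadj, Algebra.top_toSubmodule] at h5
  exact top_le_iff.1 h5

theorem frob_add {k R : Type*} [Field k] [CommRing R] [Algebra k R] (p : ℕ) (hp : p.Prime)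
    [CharP k p] (n : ℕ) (a b : R) : (a + b) ^ p ^ n = a ^ p ^ n + b ^ p ^ n := by
  rcases subsingleton_or_nontrivial R with h | h
  · exact Subsingleton.elim _ _
  · have := charP_of_injective_algebraMap (algebraMap k R).injective p
    have := Fact.mk hp
    exact add_pow_char_pow a b p n

theorem geom_char {k R : Type*} [Field k] [CommRing R] [Algebra k R] (p : ℕ) (hp : p.Prime)
    [CharP k p] (n : ℕ) (a b : R) :
    (a - b) ^ (p ^ n - 1) = ∑ i ∈ Finset.range (p ^ n), a ^ i * b ^ (p ^ n - 1 - i) := by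
  have key : ((MvPolynomial.X 0 : MvPolynomial (Fin 2) k) - MvPolynomial.X 1) ^ (p ^ n - 1) =
      ∑ i ∈ Finset.range (p ^ n), (MvPolynomial.X 0) ^ i * (MvPolynomial.X 1) ^ (p ^ n - 1 - i) := by
    have hne : ((MvPolynomial.X 0 : MvPolynomial (Fin 2) k) - MvPolynomial.X 1) ≠ 0 := by
      rw [sub_ne_zero]
      intro h
      have := MvPolynomial.X_injective h
      simp at this
    apply mul_right_cancel₀ hne
    have hq : 1 ≤ p ^ n := Nat.one_le_iff_ne_zero.2 (pow_ne_zero _ hp.ne_zero)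
    rw [geom_sum₂_mul, ← pow_succ, Nat.sub_add_cancel hq]
    have := frob_add (k := k) p hp n
      ((MvPolynomial.X 0 : MvPolynomial (Fin 2) k) - MvPolynomial.X 1) (MvPolynomial.X 1)
    rw [sub_add_cancel] at this
    rw [this]; ring
  have := congrArg (MvPolynomial.aeval ![a, b]) key
  simpa using this

def cPlus (p q s i : ℕ) : ℕ :=
  if i + s ≤ q then p * q else if i < q then (p - 1) * q else (p - 1) * q - s

noncomputable def ePlus {R : Type*} [CommRing R] (w t : R) (q s i : ℕ) : R :=
  if i + s ≤ q then t ^ i else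
    if i < q then t ^ i - w ^ (i + s - q) * t ^ (q - s)
    else t ^ q - w ^ s * t ^ (q - s) - w ^ q

def cMinus (p q s i : ℕ) : ℕ :=
  if i + s + 1 < q then p * q else if i + s + 1 = q then (p - 1) * q + s else (p - 1) * q

noncomputable def eMinus {R : Type*} [CommRing R] (w t : R) (q s i : ℕ) : R :=
  if i + s + 1 = q then ∑ j ∈ Finset.range (q - s), w ^ j * t ^ (q - s - 1 - j) else t ^ i

theorem ePlus_tri {k R : Type*} [Field k] [CommRing R] [Algebra k R] (w t : R) (q s : ℕ)
    (hs : s < q)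
    (N : Submodule k R) (i : ℕ) (hi : i < q + 1)
    (h : ∀ a, ∀ j < i, w ^ a * t ^ j ∈ N) : ePlus w t q s i - t ^ i ∈ N := by
  unfold ePlus
  split_ifs with h1 h2
  · simp
  · rw [sub_sub_cancel_left]
    exact N.neg_mem (h _ _ (by omega))
  · obtain rfl : i = q := by omega
    have := N.add_mem (h s (i - s) (by omega)) (h i 0 (by omega))
    convert N.neg_mem this using 1
    ring

theorem eMinus_tri {k R : Type*} [Field k] [CommRing R] [Algebra k R] (w t : R) (q s : ℕ)
    (N : Submodule k R) (i : ℕ)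
    (h : ∀ a, ∀ j < i, w ^ a * t ^ j ∈ N) : eMinus w t q s i - t ^ i ∈ N := by
  unfold eMinus
  split_ifs with h1
  · have : q - s = i + 1 := by omega
    rw [this, Finset.sum_range_succ']
    simp only [pow_zero, one_mul, Nat.add_sub_cancel, Nat.sub_zero, add_sub_cancel_right]
    refine N.sum_mem fun j hj => h _ _ ?_
    have := Finset.mem_range.1 hj
    omega
  · simp

theorem add_pow_sq_zero {R : Type*} [CommRing R] (A B : R) (h : B * B = 0) (n : ℕ) :
    (A + B) ^ (n + 1) = A ^ (n + 1) + (n + 1) * A ^ n * B := by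
  induction n with
  | zero => simp
  | succ n ih =>
    rw [pow_succ, ih]
    push_cast
    linear_combination (n + 1) * A ^ n * h

theorem add_pow_mul_kill {R : Type*} [CommRing R] (A B v : R) (h : B * v = 0) (n : ℕ) :
    (A + B) ^ n * v = A ^ n * v := by
  induction n with
  | zero => simp
  | succ n ih => rw [pow_succ', mul_assoc, ih]; linear_combination A ^ n * h

theorem ePlus_kill {k R : Type*} [Field k] [CommRing R] [Algebra k R] (p : ℕ) (hp : p.Prime)
    [CharP k p] (α : ℕ) (q s : ℕ) (hq : q = p ^ α) (hs : s < q) (w t : R)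
    (hu : (w - t) ^ (q + 1) = 0) (ht : t ^ (p * q - s) = 0) (i : ℕ) (hi : i < q + 1) :
    w ^ cPlus p q s i * ePlus w t q s i = 0 := by
  obtain ⟨P, rfl⟩ : ∃ P, p = P + 2 := ⟨p - 2, by have := hp.two_le; omega⟩
  obtain ⟨u, rfl⟩ : ∃ u, w = t + u := ⟨w - t, by ring⟩
  rw [add_sub_cancel_left] at hu
  obtain ⟨d, rfl⟩ : ∃ d, q = s + d := ⟨q - s, by omega⟩
  have hd : 0 < d := by omega
  have hr : (P + 2) * (s + d) - s = (P + 1) * (s + d) + d := by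
    have : (P + 2) * (s + d) = ((P + 1) * (s + d) + d) + s := by ring
    omega
  rw [hr] at ht
  have hF : (t + u) ^ (s + d) = t ^ (s + d) + u ^ (s + d) := by
    rw [hq]; exact frob_add (k := k) (P + 2) hp α t u
  have hBB : u ^ (s + d) * u ^ (s + d) = 0 := by
    rw [← pow_add]; exact pow_eq_zero_of_le (by omega) hu
  have hp0 : ((P : R) + 1 + 1) = 0 := by
    have : ((P + 2 : ℕ) : R) = algebraMap k R ((P + 2 : ℕ) : k) := (map_natCast _ _).symm
    rw [CharP.cast_eq_zero k (P + 2), map_zero] at this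
    push_cast at this
    linear_combination this
  unfold cPlus ePlus
  split_ifs with h1 h2
  · have : (t + u) ^ ((P + 2) * (s + d)) = 0 := by
      rw [mul_comm, pow_mul, hF, add_pow_sq_zero _ _ hBB]
      have e1 : (t ^ (s + d)) ^ (P + 1 + 1) = 0 := by
        rw [← pow_mul]
        exact pow_eq_zero_of_le (by nlinarith) ht
      rw [e1]
      push_cast
      rw [hp0]; ring
    rw [this, zero_mul]
  · have e1 : i + s - (s + d) = i - d := by omega
    have e2 : s + d - s = d := by omega
    rw [e1, e2]
    obtain ⟨l, rfl⟩ : ∃ l, i = d + l := ⟨i - d, by omega⟩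
    rw [Nat.add_sub_cancel_left, show P + 2 - 1 = P + 1 by omega, mul_comm (P + 1), pow_mul, hF]
    obtain ⟨g, hg⟩ : u ∣ t ^ l - (t + u) ^ l := by
      have := sub_dvd_pow_sub_pow t (t + u) l
      rwa [sub_add_cancel_left, neg_dvd] at this
    have e3 : t ^ (d + l) - (t + u) ^ l * t ^ d = u * (g * t ^ d) := by
      rw [← mul_assoc, ← hg]; ring
    rw [e3, add_pow_mul_kill]
    · rw [← pow_mul]
      rw [pow_add] at ht
      linear_combination u * g * ht
    · rw [← mul_assoc, ← pow_succ, hu, zero_mul]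
  · obtain rfl : i = s + d := by omega
    have e2 : s + d - s = d := by omega
    have hsle : s ≤ (P + 1) * (s + d) := by nlinarith
    have e4 : (P + 2 - 1) * (s + d) - s = P * (s + d) + d := by
      rw [show P + 2 - 1 = P + 1 by omega]
      have : (P + 1) * (s + d) = (P * (s + d) + d) + s := by ring
      omega
    rw [e2, e4, hF]
    have k1 : (t + u) ^ (P * (s + d) + d) * u ^ (s + d) = t ^ (P * (s + d) + d) * u ^ (s + d) := by
      apply add_pow_mul_kill
      rw [← pow_succ', hu]
    have k2 : (t + u) ^ (P * (s + d) + d) * (t + u) ^ s =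
        t ^ ((P + 1) * (s + d)) - t ^ (P * (s + d)) * u ^ (s + d) := by
      rw [← pow_add, show P * (s + d) + d + s = (s + d) * (P + 1) by ring, pow_mul, hF,
        add_pow_sq_zero _ _ hBB]
      rw [← pow_mul, ← pow_mul, mul_comm (s + d), mul_comm (s + d)]
      linear_combination t ^ (P * (s + d)) * u ^ (s + d) * hp0
    rw [pow_add] at ht
    have k3 : t ^ (P * (s + d) + d) = t ^ (P * (s + d)) * t ^ d := pow_add _ _ _
    rw [k3] at k1
    linear_combination -k1 - t ^ d * k2 - ht

theorem eMinus_kill {k R : Type*} [Field k] [CommRing R] [Algebra k R] (p : ℕ) (hp : p.Prime)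
    [CharP k p] (α : ℕ) (q s : ℕ) (hq : q = p ^ α) (hs : s < q) (w t : R)
    (hu : (w - t) ^ (q - 1) = 0) (ht : t ^ (p * q - s) = 0) (i : ℕ) (hi : i < q - 1) :
    w ^ cMinus p q s i * eMinus w t q s i = 0 := by
  obtain ⟨P, rfl⟩ : ∃ P, p = P + 1 := ⟨p - 1, by have := hp.two_le; omega⟩
  have hgeom := geom_char (k := k) (P + 1) hp α w t
  rw [← hq, hu] at hgeom
  have hF : w ^ q = t ^ q := by
    have h1 := frob_add (k := k) (P + 1) hp α (w - t) t
    rw [← hq, sub_add_cancel, pow_eq_zero_of_le (by omega) hu, zero_add] at h1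
    exact h1
  have hF' : ∀ n, w ^ (n * q) = t ^ (n * q) := by
    intro n
    rw [mul_comm, pow_mul, hF, pow_mul]
  obtain ⟨d, rfl⟩ : ∃ d, q = s + d := ⟨q - s, by omega⟩
  have hd : 0 < d := by omega
  have hr : (P + 1) * (s + d) - s = P * (s + d) + d := by
    have : (P + 1) * (s + d) = (P * (s + d) + d) + s := by ring
    omega
  rw [hr] at ht
  unfold cMinus eMinus
  split_ifs with h1 h2 h2
  · omega
  · rw [hF', pow_eq_zero_of_le (by nlinarith) ht, zero_mul]
  · rw [Nat.add_sub_cancel, pow_add, hF', Nat.add_sub_cancel_left]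
    rw [Finset.sum_range_add] at hgeom
    have e1 : ∑ j ∈ Finset.range d, w ^ (s + j) * t ^ (s + d - 1 - (s + j)) =
        w ^ s * ∑ j ∈ Finset.range d, w ^ j * t ^ (d - 1 - j) := by
      rw [Finset.mul_sum]
      refine Finset.sum_congr rfl fun j hj => ?_
      rw [show s + d - 1 - (s + j) = d - 1 - j by omega]; ring
    have e2 : ∑ j ∈ Finset.range s, w ^ j * t ^ (s + d - 1 - j) =
        t ^ d * ∑ j ∈ Finset.range s, w ^ j * t ^ (s - 1 - j) := by
      rw [Finset.mul_sum]
      refine Finset.sum_congr rfl fun j hj => ?_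
      have := Finset.mem_range.1 hj
      rw [show s + d - 1 - j = d + (s - 1 - j) by omega]; ring
    rw [e1, e2] at hgeom
    rw [pow_add] at ht
    linear_combination -t ^ (P * (s + d)) * hgeom - (∑ j ∈ Finset.range s, w ^ j * t ^ (s - 1 - j)) * ht
  · rw [Nat.add_sub_cancel, hF', ← pow_add]
    exact pow_eq_zero_of_le (by omega) ht

theorem map_fin_univ (n : ℕ) (c : ℕ → ℕ) :
    (Finset.univ : Finset (Fin n)).val.map (fun i : Fin n => c i) = (Multiset.range n).map c := by
  have h := congrArg Finset.val (Fin.map_valEmbedding_univ (n := n))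
  rw [Finset.map_val, Nat.Iio_eq_range, Finset.range_val] at h
  rw [← h, Multiset.map_map]
  rfl

theorem map_range_const (c : ℕ → ℕ) (n v : ℕ) (h : ∀ i < n, c i = v) :
    (Multiset.range n).map c = Multiset.replicate n v := by
  rw [Multiset.map_congr rfl (g := fun _ => v) (fun i hi => h i (Multiset.mem_range.1 hi))]
  simp

theorem map_range_add (c : ℕ → ℕ) (m n : ℕ) :
    (Multiset.range (m + n)).map c =
      (Multiset.range m).map c + (Multiset.range n).map (fun i => c (m + i)) := by
  rw [Multiset.range_add, Multiset.map_add, Multiset.map_map]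
  rfl

theorem sPlus_zero (p q : ℕ) :
    (Multiset.range (q + 1)).map (cPlus p q 0) = Multiset.replicate (q + 1) (p * q) :=
  map_range_const _ _ _ fun i hi => by unfold cPlus; rw [if_pos (by omega)]

theorem sMinus_zero (p q : ℕ) :
    (Multiset.range (q - 1)).map (cMinus p q 0) = Multiset.replicate (q - 1) (p * q) :=
  map_range_const _ _ _ fun i hi => by unfold cMinus; rw [if_pos (by omega)]

theorem sPlus_succ (p b d q : ℕ) (hq : q = d + b + 2) :
    (Multiset.range (q + 1)).map (cPlus p q (b + 1)) =
      Multiset.replicate (d + 2) (p * q) + Multiset.replicate b ((p - 1) * q) +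
        {(p - 1) * q - (b + 1)} := by
  rw [show q + 1 = (d + 2) + b + 1 by omega, map_range_add, map_range_add]
  congr 1
  · congr 1
    · exact map_range_const _ _ _ fun i hi => by unfold cPlus; rw [if_pos (by omega)]
    · exact map_range_const _ _ _ fun i hi => by
        unfold cPlus; rw [if_neg (by omega), if_pos (by omega)]
  · rw [← Multiset.replicate_one]
    exact map_range_const _ _ _ fun i hi => by
        unfold cPlus; rw [if_neg (by omega), if_neg (by omega)]

theorem sMinus_succ (p b d q : ℕ) (hq : q = d + b + 2) :
    (Multiset.range (q - 1)).map (cMinus p q (b + 1)) =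
      Multiset.replicate d (p * q) + {(p - 1) * q + (b + 1)} +
        Multiset.replicate b ((p - 1) * q) := by
  rw [show q - 1 = d + 1 + b by omega, map_range_add, map_range_add]
  congr 1
  · congr 1
    · exact map_range_const _ _ _ fun i hi => by unfold cMinus; rw [if_pos (by omega)]
    · rw [← Multiset.replicate_one]
      exact map_range_const _ _ _ fun i hi => by
        unfold cMinus; rw [if_neg (by omega), if_pos (by omega)]
  · exact map_range_const _ _ _ fun i hi => by
        unfold cMinus; rw [if_neg (by omega), if_neg (by omega)]

theorem sum_plus (p q s : ℕ) (hp : 2 ≤ p) (hs : s < q) :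
    ((Multiset.range (q + 1)).map (cPlus p q s)).sum = (q + 1) * (p * q - s) := by
  obtain ⟨P, rfl⟩ : ∃ P, p = P + 2 := ⟨p - 2, by omega⟩
  rcases s with _ | b
  · rw [sPlus_zero, Multiset.sum_replicate, smul_eq_mul, Nat.sub_zero]
  · obtain ⟨d, hd⟩ : ∃ d, q = d + b + 2 := ⟨q - b - 2, by omega⟩
    rw [sPlus_succ _ b d q hd]
    simp only [Multiset.sum_add, Multiset.sum_replicate, Multiset.sum_singleton, smul_eq_mul]
    have h1 : (P + 2 - 1) * q - (b + 1) = P * q + d + 1 := by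
      rw [show P + 2 - 1 = P + 1 by omega, add_mul]; omega
    have h2 : (P + 2) * q - (b + 1) = (P + 1) * q + d + 1 := by
      rw [show P + 2 = P + 1 + 1 by omega, add_mul (P + 1)]; omega
    rw [h1, h2, show P + 2 - 1 = P + 1 by omega, hd]
    ring

theorem sum_minus (p q s : ℕ) (hp : 2 ≤ p) (hs : s < q) :
    ((Multiset.range (q - 1)).map (cMinus p q s)).sum = (q - 1) * (p * q - s) := by
  obtain ⟨P, rfl⟩ : ∃ P, p = P + 2 := ⟨p - 2, by omega⟩
  rcases s with _ | b
  · rw [sMinus_zero, Multiset.sum_replicate, smul_eq_mul, Nat.sub_zero]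
  · obtain ⟨d, hd⟩ : ∃ d, q = d + b + 2 := ⟨q - b - 2, by omega⟩
    rw [sMinus_succ _ b d q hd]
    simp only [Multiset.sum_add, Multiset.sum_replicate, Multiset.sum_singleton, smul_eq_mul]
    have h2 : (P + 2) * q - (b + 1) = (P + 1) * q + d + 1 := by
      rw [show P + 2 = P + 1 + 1 by omega, add_mul (P + 1)]; omega
    rw [h2, show P + 2 - 1 = P + 1 by omega, show q - 1 = d + b + 1 by omega, hd]
    ring

theorem final_multiset (p q s : ℕ) (hp : 2 ≤ p) (hs : s < q) :
    ((2 * p - 1) * q - (p * q - s)) ::ₘ (Multiset.range (q + 1)).map (cPlus p q s) =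
      (p * q) ::ₘ (p * q) ::ₘ (p * q - s - q) ::ₘ (Multiset.range (q - 1)).map (cMinus p q s) := by
  obtain ⟨P, rfl⟩ : ∃ P, p = P + 1 := ⟨p - 1, by omega⟩
  have h1 : (2 * (P + 1) - 1) * q - ((P + 1) * q - s) = P * q + s := by
    have e1 : (2 * (P + 1) - 1) * q = P * q + P * q + q := by
      rw [show 2 * (P + 1) - 1 = P + P + 1 by omega]; ring
    have e2 : (P + 1) * q = P * q + q := by ring
    rw [e1, e2]
    omega
  have h2 : (P + 1) * q - s - q = P * q - s := by
    have e2 : (P + 1) * q = P * q + q := by ring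
    rw [e2]; omega
  rw [h1, h2]
  rcases s with _ | b
  · rw [sPlus_zero, sMinus_zero]
    obtain ⟨n, rfl⟩ : ∃ n, q = n + 1 := ⟨q - 1, by omega⟩
    rw [Nat.add_sub_cancel, Multiset.replicate_succ, Multiset.replicate_succ]
    simp only [← Multiset.singleton_add, Nat.add_zero, Nat.sub_zero]
    abel
  · obtain ⟨d, hd⟩ : ∃ d, q = d + b + 2 := ⟨q - b - 2, by omega⟩
    rw [sPlus_succ _ b d q hd, sMinus_succ _ b d q hd, Multiset.replicate_succ,
      Multiset.replicate_succ, Nat.add_sub_cancel]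
    simp only [← Multiset.singleton_add]
    abel

theorem tensor_facts_aux {k A B : Type*} [Field k] [CommRing A] [CommRing B] [Algebra k A]
    [Algebra k B] (p : ℕ) (hp : p.Prime) [CharP k p] (n m r : ℕ)
    (hn : m ≤ p ^ n) (a : A) (b : B) (ha : (a - 1) ^ m = 0) (hb : (b - 1) ^ r = 0)
    (hA : ∀ v : A, ∃ g : k[X], v = aeval a g) (hB : ∀ v : B, ∃ g : k[X], v = aeval b g) :
    ∃ z t : A ⊗[k] B,
      TensorProduct.map (LinearMap.mulLeft k a) (LinearMap.mulLeft k b) = LinearMap.mulLeft k z ∧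
      (z - 1 - t) ^ m = 0 ∧ t ^ r = 0 ∧ Algebra.adjoin k {z - 1, t} = ⊤ := by
  let x : A ⊗[k] B := a ⊗ₜ 1
  let y : A ⊗[k] B := 1 ⊗ₜ b
  have hxA : ∀ g : k[X], (aeval a g) ⊗ₜ[k] (1 : B) = aeval x g := fun g =>
    (aeval_algHom_apply (Algebra.TensorProduct.includeLeft : A →ₐ[k] A ⊗[k] B) a g).symm
  have hyB : ∀ g : k[X], (1 : A) ⊗ₜ[k] (aeval b g) = aeval y g := fun g =>
    (aeval_algHom_apply (Algebra.TensorProduct.includeRight : B →ₐ[k] A ⊗[k] B) b g).symm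
  have hx : (x - 1) ^ m = 0 := by
    have : (x - 1) ^ m = (Algebra.TensorProduct.includeLeft : A →ₐ[k] A ⊗[k] B) ((a - 1) ^ m) := by
      rw [map_pow, map_sub, map_one]; rfl
    rw [this, ha, map_zero]
  have hy : (y - 1) ^ r = 0 := by
    have : (y - 1) ^ r = (Algebra.TensorProduct.includeRight : B →ₐ[k] A ⊗[k] B) ((b - 1) ^ r) := by
      rw [map_pow, map_sub, map_one]; rfl
    rw [this, hb, map_zero]
  have hxy : a ⊗ₜ[k] b = x * y := by
    simp [x, y, Algebra.TensorProduct.tmul_mul_tmul]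
  refine ⟨x * y, x * (y - 1), ?_, ?_, ?_, ?_⟩
  · rw [← hxy]
    apply TensorProduct.ext'
    intro v w
    simp only [TensorProduct.map_tmul, LinearMap.mulLeft_apply, Algebra.TensorProduct.tmul_mul_tmul]
  · rw [← hx]; congr 1; ring
  · rw [mul_pow, hy, mul_zero]
  · rw [eq_top_iff]
    set S := Algebra.adjoin k {x * y - 1, x * (y - 1)}
    have hz : x * y - 1 ∈ S := Algebra.subset_adjoin (by simp)
    have ht : x * (y - 1) ∈ S := Algebra.subset_adjoin (by simp)
    have hz' : x * y ∈ S := by simpa using S.add_mem hz S.one_mem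
    have hxS : x ∈ S := by
      have := S.sub_mem hz' ht
      convert this using 1; ring
    have hx1 : x ^ p ^ n = 1 := by
      have := frob_add (k := k) p hp n (x - 1) 1
      rwa [sub_add_cancel, pow_eq_zero_of_le hn hx, zero_add, one_pow] at this
    have hyS : y ∈ S := by
      have := S.mul_mem (S.pow_mem hxS (p ^ n - 1)) hz'
      rwa [← mul_assoc, ← pow_succ, Nat.sub_add_cancel (Nat.one_le_iff_ne_zero.2
        (pow_ne_zero _ hp.ne_zero)), hx1, one_mul] at this
    have hae : ∀ (g : k[X]) (c : A ⊗[k] B), c ∈ S → aeval c g ∈ S := fun g c hc =>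
      (Algebra.adjoin_le (Set.singleton_subset_iff.2 hc) : Algebra.adjoin k {c} ≤ S)
        (aeval_mem_adjoin_singleton k c)
    intro v _
    induction v using TensorProduct.induction_on with
    | zero => exact S.zero_mem
    | add v w hv hw => exact S.add_mem (hv trivial) (hw trivial)
    | tmul v w =>
      obtain ⟨g, rfl⟩ := hA v
      obtain ⟨h, rfl⟩ := hB w
      have : (aeval a g) ⊗ₜ[k] (aeval b h) =
          aeval x g * aeval y h := by
        rw [← hxA, ← hyB, Algebra.TensorProduct.tmul_mul_tmul, mul_one, one_mul]
      rw [this]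
      exact S.mul_mem (hae g x hxS) (hae h y hyS)

theorem tensor_facts (k : Type*) [Field k] (p : ℕ) (hp : p.Prime) [CharP k p] (n m r : ℕ)
    (hn : m ≤ p ^ n) :
    ∃ z t : (k[X] ⧸ Ideal.span {((X : k[X]) - 1) ^ m}) ⊗[k]
        (k[X] ⧸ Ideal.span {((X : k[X]) - 1) ^ r}),
      TensorProduct.map (mulXop k ((X - 1) ^ m)) (mulXop k ((X - 1) ^ r)) = LinearMap.mulLeft k z ∧
      (z - 1 - t) ^ m = 0 ∧ t ^ r = 0 ∧ Algebra.adjoin k {z - 1, t} = ⊤ := by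
  have h0 : ∀ m : ℕ, ((Ideal.Quotient.mk (Ideal.span {((X : k[X]) - 1) ^ m}) X) - 1) ^ m = 0 := by
    intro m
    rw [← map_one (Ideal.Quotient.mk (Ideal.span {((X : k[X]) - 1) ^ m})), ← map_sub, ← map_pow,
      Ideal.Quotient.eq_zero_iff_mem]
    exact Ideal.mem_span_singleton_self _
  have h1 : ∀ m : ℕ, ∀ v : k[X] ⧸ Ideal.span {((X : k[X]) - 1) ^ m}, ∃ g : k[X],
      v = aeval (Ideal.Quotient.mk (Ideal.span {((X : k[X]) - 1) ^ m}) X) g := by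
    intro m v
    obtain ⟨g, rfl⟩ := Ideal.Quotient.mk_surjective v
    refine ⟨g, ?_⟩
    have := (aeval_algHom_apply (Ideal.Quotient.mkₐ k (Ideal.span {((X : k[X]) - 1) ^ m})) X g)
    rw [aeval_X_left_apply] at this
    exact this.symm
  exact tensor_facts_aux p hp n m r hn _ _ (h0 m) (h0 r) (h1 m) (h1 r)

theorem tensor_hasType.{u} (k : Type u) [Field k] (p : ℕ) (hp : p.Prime) [CharP k p] (n m r : ℕ)
    (hn : m ≤ p ^ n) (c : ℕ → ℕ)
    (e : ∀ {R : Type u} [CommRing R], R → R → ℕ → R)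
    (hkill : ∀ {R : Type u} [CommRing R] [Algebra k R] (w t : R), (w - t) ^ m = 0 → t ^ r = 0 →
      ∀ i < m, w ^ c i * e w t i = 0)
    (htri : ∀ {R : Type u} [CommRing R] [Algebra k R] (w t : R) (N : Submodule k R), ∀ i < m,
      (∀ a, ∀ j < i, w ^ a * t ^ j ∈ N) → e w t i - t ^ i ∈ N)
    (hsum : ((Multiset.range m).map c).sum = m * r) :
    HasType (TensorProduct.map (mulXop k ((X - 1) ^ m)) (mulXop k ((X - 1) ^ r)))
      ((Multiset.range m).map c) := by
  obtain ⟨z, t, h1, h2, h3, h4⟩ := tensor_facts k p hp n m r hn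
  refine ⟨Fin m, inferInstance, fun i => c i, map_fin_univ m c, ?_⟩
  rw [h1]
  refine hasType_of_gens (k := k) z (fun i : Fin m => e (z - 1) t i) (fun i => c i)
    (fun i => hkill _ _ h2 h3 i i.2) ?_ ?_
  · intro N hN he
    exact span_of_tri z t m h2 h4 (e (z - 1) t) N hN (fun i hi => he ⟨i, hi⟩)
      (fun i hi => htri (z - 1) t N i hi)
  · rw [Module.finrank_tensorProduct, finrank_quot, finrank_quot, ← hsum, ← map_fin_univ]
    rfl

end aux

theorem stmt12 {k : Type*} [Field k] (p : ℕ) (hp : 0 < p) [CharP k p] (α : ℕ)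
    (q : ℕ) (hq : q = p ^ α) (r : ℕ) (hr1 : (p - 1) * q < r) (hrq : r ≤ p * q) :
    OpIso
      ((TensorProduct.map (mulXop k ((X - 1) ^ (q + 1))) (mulXop k ((X - 1) ^ r))).prodMap
        (mulXop k ((X - 1) ^ ((2 * p - 1) * q - r))))
      ((((TensorProduct.map (mulXop k ((X - 1) ^ (q - 1))) (mulXop k ((X - 1) ^ r))).prodMap
            (mulXop k ((X - 1) ^ (r - q)))).prodMap
          (mulXop k ((X - 1) ^ (p * q)))).prodMap
        (mulXop k ((X - 1) ^ (p * q)))) := by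
  have hpp : p.Prime := (CharP.char_is_prime_or_zero k p).resolve_right (by omega)
  have hp2 := hpp.two_le
  have hpq : p * q = (p - 1) * q + q := by
    obtain ⟨P, rfl⟩ : ∃ P, p = P + 1 := ⟨p - 1, by omega⟩
    rw [Nat.add_sub_cancel]; ring
  obtain ⟨s, hs, rfl⟩ : ∃ s, s < q ∧ r = p * q - s := ⟨p * q - r, by omega, by omega⟩
  have hn : q + 1 ≤ p ^ (α + 1) := by
    rw [pow_succ, ← hq]
    nlinarith
  have hP := tensor_hasType k p hpp (α + 1) (q + 1) (p * q - s) hn (cPlus p q s)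
    (fun w t i => ePlus w t q s i)
    (fun w t h1 h2 i hi => ePlus_kill (k := k) p hpp α q s hq hs w t h1 h2 i hi)
    (fun w t N i hi h => ePlus_tri w t q s hs N i hi h) (sum_plus p q s hp2 hs)
  have hM := tensor_hasType k p hpp (α + 1) (q - 1) (p * q - s) (by omega) (cMinus p q s)
    (fun w t i => eMinus w t q s i)
    (fun w t h1 h2 i hi => eMinus_kill (k := k) p hpp α q s hq hs w t h1 h2 i hi)
    (fun w t N i _ h => eMinus_tri w t q s N i h) (sum_minus p q s hp2 hs)
  have h1 := hP.cons ((2 * p - 1) * q - (p * q - s))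
  rw [final_multiset p q s hp2 hs] at h1
  exact h1.opIso (((hM.cons (p * q - s - q)).cons (p * q)).cons (p * q))
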